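/- Let n ≥ 1 and T > 0. Let A : ℝ → ℝ^{n×n} be continuous and T-periodic, and let Q : ℝ → ℝ^{n×n} be continuous, T-periodic, with each Q(t) symmetric and satisfying ⟨x, Q(t) x⟩ ≥ q₀‖x‖² for all x and t, for some q₀ > 0. Then the following are equivalent: (a) there exist constants K > 0 and λ > 0 such that every differentiable solution x : ℝ → ℝⁿ of x′(t) = A(t)x(t) satisfies ‖x(t)‖ ≤ K e^{−λ(t−s)} ‖x(s)‖ for all t ≥ s; (b) there exist a continuously differentiable T-periodic matrix function P : ℝ → ℝ^{n×n}, with each P(t) symmetric, and constants p₁ ≥ p₀ > 0 with p₀‖x‖² ≤ ⟨x, P(t) x⟩ ≤ p₁‖x‖² for all x and t, such that P′(t) + A(t)ᵀP(t) + P(t)A(t) + Q(t) = 0 for all t. -/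

import Mathlib

open scoped RealInnerProductSpace NNReal BoundedContinuousFunction

/-- Matrix–vector multiplication as a map between Euclidean spaces. -/
noncomputable def mulVecE {m n : ℕ} (A : Matrix (Fin m) (Fin n) ℝ)
    (v : EuclideanSpace ℝ (Fin n)) : EuclideanSpace ℝ (Fin m) :=
  (EuclideanSpace.equiv (Fin m) ℝ).symm (A.mulVec (EuclideanSpace.equiv (Fin n) ℝ v))

/-- An exponentially weighted bound on the integrand gives one on the primitive based at `0`. -/
theorem norm_integral_le_exp_mul_abs {F : Type*} [NormedAddCommGroup F] [NormedSpace ℝ F]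
    {c C : ℝ} (hc : 0 < c) (hC : 0 ≤ C) {g : ℝ → F}
    (hg : ∀ s, ‖g s‖ ≤ C * Real.exp (c * |s|)) (t : ℝ) :
    ‖∫ s in (0 : ℝ)..t, g s‖ ≤ C / c * Real.exp (c * |t|) := by
  have forward : ∀ h : ℝ → F, (∀ s, ‖h s‖ ≤ C * Real.exp (c * |s|)) → ∀ r : ℝ, 0 ≤ r →
      ‖∫ s in (0 : ℝ)..r, h s‖ ≤ C / c * Real.exp (c * r) := by
    intro h hh r hr
    have key : ∫ s in (0 : ℝ)..r, C * Real.exp (c * s) = C / c * Real.exp (c * r) - C / c := by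
      rw [intervalIntegral.integral_const_mul,
        intervalIntegral.integral_comp_mul_left (fun x => Real.exp x) hc.ne', integral_exp]
      simp
      ring
    refine (intervalIntegral.norm_integral_le_of_norm_le (g := fun s => C * Real.exp (c * s)) hr
      ?_ (Continuous.intervalIntegrable (by fun_prop) _ _)).trans ?_
    · refine Filter.Eventually.of_forall fun s hs => ?_
      simpa [abs_of_pos hs.1] using hh s
    · rw [key]
      have : 0 ≤ C / c := by positivity
      linarith
  rcases le_total 0 t with ht | ht
  · simpa [abs_of_nonneg ht] using forward g hg t ht
  · have h := forward (fun s => g (-s)) (fun s => by simpa using hg (-s)) (-t) (by linarith)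
    rw [intervalIntegral.integral_comp_neg, intervalIntegral.integral_symm, norm_neg] at h
    simpa [abs_of_nonpos ht] using h

/-- Global Cauchy–Lipschitz theorem for a globally Lipschitz time-dependent vector field. -/
theorem exists_hasDerivAt_of_lipschitzWith {F : Type*} [NormedAddCommGroup F] [NormedSpace ℝ F]
    [CompleteSpace F] {f : ℝ → F → F} {K : ℝ≥0} {M : ℝ}
    (hf : Continuous fun z : ℝ × F => f z.1 z.2) (hK : ∀ t, LipschitzWith K (f t))
    (hM : ∀ t, ‖f t 0‖ ≤ M) (t₀ : ℝ) (x₀ : F) :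
    ∃ x : ℝ → F, x t₀ = x₀ ∧ ∀ t, HasDerivAt x (f t (x t)) t := by
  wlog ht₀ : t₀ = 0 generalizing f t₀
  · obtain ⟨x, hx0, hx⟩ := this (f := fun t => f (t + t₀))
      (hf.comp (by fun_prop : Continuous fun z : ℝ × F => (z.1 + t₀, z.2)))
      (fun t => hK _) (fun t => hM _) 0 rfl
    refine ⟨fun t => x (t - t₀), by simpa using hx0, fun t => ?_⟩
    simpa using (hx (t - t₀)).comp_sub_const t t₀
  subst ht₀
  have hM0 : 0 ≤ M := (norm_nonneg _).trans (hM 0)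
  let c : ℝ := 2 * K + 1
  have hc : 0 < c := by positivity
  let w : ℝ → ℝ := fun t => Real.exp (c * |t|)
  have hwc : Continuous w := by fun_prop
  have hwpos : ∀ t, 0 < w t := fun t => Real.exp_pos _
  have hw1 : ∀ t, 1 ≤ w t := fun t => Real.one_le_exp (by positivity)
  have hcont : ∀ y : ℝ →ᵇ F, Continuous fun s => f s (w s • y s) := fun y =>
    hf.comp (continuous_id.prodMk (hwc.smul y.continuous))
  have hbound : ∀ y : ℝ →ᵇ F, ∀ s, ‖f s (w s • y s)‖ ≤ (M + K * ‖y‖) * w s := by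
    intro y s
    have h1 : ‖f s (w s • y s) - f s 0‖ ≤ K * (w s * ‖y s‖) := by
      simpa [norm_smul, abs_of_pos (hwpos s)] using (hK s).norm_sub_le (w s • y s) 0
    have h2 : ‖f s (w s • y s)‖ ≤ ‖f s (w s • y s) - f s 0‖ + ‖f s 0‖ := norm_le_norm_sub_add _ _
    have h3 : (K : ℝ) * (w s * ‖y s‖) ≤ K * (w s * ‖y‖) := by
      have := y.norm_coe_le_norm s
      have := (hwpos s).le
      gcongr
    nlinarith [hM s, hw1 s]
  have hprim : ∀ y : ℝ →ᵇ F, ∀ t, HasDerivAt (fun t => x₀ + ∫ s in (0 : ℝ)..t, f s (w s • y s))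
      (f t (w t • y t)) t := fun y t =>
    ((hcont y).integral_hasStrictDerivAt 0 t).hasDerivAt.const_add x₀
  let G : (ℝ →ᵇ F) → (ℝ →ᵇ F) := fun y => BoundedContinuousFunction.ofNormedAddCommGroup
    (fun t => (w t)⁻¹ • (x₀ + ∫ s in (0 : ℝ)..t, f s (w s • y s)))
    ((hwc.inv₀ fun t => (hwpos t).ne').smul
      (continuous_iff_continuousAt.2 fun t => (hprim y t).continuousAt))
    (‖x₀‖ + (M + K * ‖y‖) / c) (by
      intro t
      have hi := norm_integral_le_exp_mul_abs hc (by positivity) (hbound y) t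
      rw [norm_smul, norm_inv, Real.norm_of_nonneg (hwpos t).le, inv_mul_le_iff₀ (hwpos t)]
      refine (norm_add_le _ _).trans ?_
      change _ ≤ _ * w t at hi
      nlinarith [norm_nonneg x₀, hw1 t])
  have hG : ContractingWith (1 / 2) G := by
    refine ⟨by rw [← NNReal.coe_lt_coe]; norm_num, LipschitzWith.of_dist_le_mul fun y z => ?_⟩
    refine (BoundedContinuousFunction.dist_le (by positivity)).2 fun t => ?_
    have hi := norm_integral_le_exp_mul_abs (g := fun s => f s (w s • y s) - f s (w s • z s))
      (C := K * dist y z) hc (by positivity) (fun s => by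
        refine ((hK s).norm_sub_le _ _).trans ?_
        rw [← smul_sub, norm_smul, Real.norm_of_nonneg (hwpos s).le, ← dist_eq_norm, mul_assoc,
          mul_comm (w s)]
        have := y.dist_coe_le_dist (g := z) s
        have := (hwpos s).le
        gcongr) t
    rw [intervalIntegral.integral_sub ((hcont y).intervalIntegrable _ _)
      ((hcont z).intervalIntegrable _ _)] at hi
    have hKc : (K : ℝ) * dist y z / c ≤ 1 / 2 * dist y z := by
      rw [div_le_iff₀ hc]
      have := dist_nonneg (x := y) (y := z)
      simp only [c]
      nlinarith
    change dist ((w t)⁻¹ • (_ : F)) ((w t)⁻¹ • (_ : F)) ≤ _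
    rw [dist_eq_norm, ← smul_sub, add_sub_add_left_eq_sub, norm_smul, norm_inv,
      Real.norm_of_nonneg (hwpos t).le, inv_mul_le_iff₀ (hwpos t)]
    refine hi.trans ?_
    rw [mul_comm (w t)]
    push_cast
    exact mul_le_mul_of_nonneg_right hKc (hwpos t).le
  obtain ⟨y, hy⟩ : ∃ y, G y = y := ⟨_, hG.fixedPoint_isFixedPt⟩
  have hx : (fun t => w t • y t) = fun t => x₀ + ∫ s in (0 : ℝ)..t, f s (w s • y s) := by
    ext1 t
    conv_lhs => rw [← hy]
    exact smul_inv_smul₀ (hwpos t).ne' _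
  refine ⟨fun t => w t • y t, ?_, fun t => ?_⟩
  · simpa using congrFun hx 0
  · rw [hx]
    have := hprim y t
    rwa [congrFun hx t] at this

/-- A continuous periodic function with values in a normed group is bounded. -/
theorem exists_norm_le_of_periodic {F : Type*} [NormedAddCommGroup F] {f : ℝ → F} {T : ℝ}
    (hT : 0 < T) (hf : Continuous f) (hper : Function.Periodic f T) :
    ∃ C, 0 ≤ C ∧ ∀ t, ‖f t‖ ≤ C := by
  obtain ⟨C, hC⟩ := (hper.isBounded_of_continuous hT.ne' hf).exists_norm_le
  exact ⟨C, (norm_nonneg _).trans (hC (f 0) ⟨0, rfl⟩), fun t => hC _ ⟨t, rfl⟩⟩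

section PeriodicAffine

variable {F : Type*} [NormedAddCommGroup F] [NormedSpace ℝ F] {B : ℝ → F →L[ℝ] F} {T : ℝ}

theorem eq_of_hasDerivAt_affine (hT : 0 < T) (hB : Continuous B) (hBper : Function.Periodic B T)
    {b x y : ℝ → F} (hx : ∀ t, HasDerivAt x (B t (x t) + b t) t)
    (hy : ∀ t, HasDerivAt y (B t (y t) + b t) t) {t₀ : ℝ} (h : x t₀ = y t₀) : x = y := by
  obtain ⟨C, hC0, hC⟩ := exists_norm_le_of_periodic hT hB hBper
  refine ODE_solution_unique_univ (v := fun t z => B t z + b t) (s := fun _ => Set.univ)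
    (K := ⟨C, hC0⟩) (fun t => LipschitzWith.lipschitzOnWith ?_)
    (fun t => ⟨hx t, trivial⟩) (fun t => ⟨hy t, trivial⟩) h
  refine LipschitzWith.of_dist_le_mul fun u v => ?_
  rw [dist_add_right, dist_eq_norm, dist_eq_norm, ← map_sub]
  exact (B t).le_of_opNorm_le (hC t) _

theorem exists_hasDerivAt_affine [CompleteSpace F] (hT : 0 < T) (hB : Continuous B)
    (hBper : Function.Periodic B T) {b : ℝ → F} (hb : Continuous b)
    (hbper : Function.Periodic b T) (t₀ : ℝ) (x₀ : F) :
    ∃ x : ℝ → F, x t₀ = x₀ ∧ ∀ t, HasDerivAt x (B t (x t) + b t) t := by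
  obtain ⟨C, hC0, hC⟩ := exists_norm_le_of_periodic hT hB hBper
  obtain ⟨M, -, hM⟩ := exists_norm_le_of_periodic hT hb hbper
  refine exists_hasDerivAt_of_lipschitzWith (f := fun t z => B t z + b t) (K := ⟨C, hC0⟩) (M := M)
    (by fun_prop) (fun t => LipschitzWith.of_dist_le_mul fun u v => ?_) (by simpa using hM) t₀ x₀
  rw [dist_add_right, dist_eq_norm, dist_eq_norm, ← map_sub]
  exact (B t).le_of_opNorm_le (hC t) _

theorem exists_hasDerivAt_linear [CompleteSpace F] (hT : 0 < T) (hB : Continuous B)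
    (hBper : Function.Periodic B T) (t₀ : ℝ) (x₀ : F) :
    ∃ x : ℝ → F, x t₀ = x₀ ∧ ∀ t, HasDerivAt x (B t (x t)) t := by
  simpa using exists_hasDerivAt_affine hT hB hBper (b := fun _ => 0) continuous_const
    (fun _ => rfl) t₀ x₀

theorem periodic_of_hasDerivAt_affine (hT : 0 < T) (hB : Continuous B)
    (hBper : Function.Periodic B T) {b : ℝ → F} (hbper : Function.Periodic b T) {x : ℝ → F}
    (hx : ∀ t, HasDerivAt x (B t (x t) + b t) t) (h : x T = x 0) : Function.Periodic x T := by
  have hshift : ∀ t, HasDerivAt (fun t => x (t + T)) (B t (x (t + T)) + b t) t := fun t => by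
    simpa only [hBper t, hbper t] using (hx (t + T)).comp_add_const t T
  exact congrFun (eq_of_hasDerivAt_affine hT hB hBper hshift hx (t₀ := 0) (by simpa using h))

/-- Fredholm alternative for periodic linear systems: if the homogeneous system has no nonzero
periodic solution, then every periodically forced system has a periodic solution. -/
theorem exists_periodic_hasDerivAt_affine [FiniteDimensional ℝ F] (hT : 0 < T)
    (hB : Continuous B) (hBper : Function.Periodic B T)
    (hhom : ∀ x : ℝ → F, (∀ t, HasDerivAt x (B t (x t)) t) → Function.Periodic x T → x 0 = 0)
    {b : ℝ → F} (hb : Continuous b) (hbper : Function.Periodic b T) :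
    ∃ x : ℝ → F, (∀ t, HasDerivAt x (B t (x t) + b t) t) ∧ Function.Periodic x T := by
  have : CompleteSpace F := FiniteDimensional.complete ℝ F
  choose sol hsol0 hsol using exists_hasDerivAt_linear hT hB hBper 0
  have huniq : ∀ {x y : ℝ → F}, (∀ t, HasDerivAt x (B t (x t)) t) →
      (∀ t, HasDerivAt y (B t (y t)) t) → x 0 = y 0 → x = y := fun hx hy h =>
    eq_of_hasDerivAt_affine hT hB hBper (b := fun _ => 0) (by simpa using hx)
      (by simpa using hy) h
  let D : F →ₗ[ℝ] F :=
    { toFun := fun u => sol u T - u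
      map_add' := fun u v => by
        have h : sol (u + v) = sol u + sol v := huniq (hsol _)
          (fun t => by simpa using (hsol u t).add (hsol v t)) (by simp [hsol0])
        rw [h, Pi.add_apply]
        abel
      map_smul' := fun r u => by
        have h : sol (r • u) = r • sol u := huniq (hsol _)
          (fun t => by simpa using (hsol u t).const_smul r) (by simp [hsol0])
        rw [h, Pi.smul_apply, RingHom.id_apply, smul_sub] }
  have hDinj : Function.Injective D := by
    refine (injective_iff_map_eq_zero D).2 fun u hu => ?_
    rw [← hsol0 u]
    refine hhom _ (hsol u) (periodic_of_hasDerivAt_affine hT hB hBper (b := fun _ => 0)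
      (fun _ => rfl) (by simpa using hsol u) ?_)
    rw [hsol0]
    exact sub_eq_zero.1 hu
  obtain ⟨p, -, hp⟩ := exists_hasDerivAt_affine hT hB hBper hb hbper 0 0
  obtain ⟨u, hu⟩ := LinearMap.injective_iff_surjective.1 hDinj (p 0 - p T)
  have hsum : ∀ t, HasDerivAt (fun t => p t + sol u t) (B t (p t + sol u t) + b t) t := fun t => by
    convert! (hp t).add (hsol u t) using 1
    rw [map_add]
    abel
  refine ⟨_, hsum, periodic_of_hasDerivAt_affine hT hB hBper hbper hsum ?_⟩
  have hu' : sol u T - u = p 0 - p T := hu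
  rw [hsol0, eq_add_of_sub_eq hu']
  abel

end PeriodicAffine

section Lyapunov

open ContinuousLinearMap Filter Topology

variable {E : Type*} [NormedAddCommGroup E] [InnerProductSpace ℝ E]

/-- Uniform exponential stability of the linear system `x' = a(t) x`. -/
def IsExpStable (a : ℝ → E →L[ℝ] E) : Prop :=
  ∃ K > (0 : ℝ), ∃ lam > (0 : ℝ), ∀ x : ℝ → E, (∀ t, HasDerivAt x (a t (x t)) t) →
    ∀ s t : ℝ, s ≤ t → ‖x t‖ ≤ K * Real.exp (-lam * (t - s)) * ‖x s‖

theorem IsExpStable.tendsto_zero {a : ℝ → E →L[ℝ] E} (ha : IsExpStable a) {x : ℝ → E}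
    (hx : ∀ t, HasDerivAt x (a t (x t)) t) : Tendsto x atTop (𝓝 0) := by
  obtain ⟨K, -, lam, hlam, h⟩ := ha
  have hexp : Tendsto (fun t : ℝ => K * Real.exp (-lam * (t - 0)) * ‖x 0‖) atTop (𝓝 0) := by
    have : Tendsto (fun t : ℝ => -lam * (t - 0)) atTop atBot := by
      simpa using tendsto_id.const_mul_atTop_of_neg (neg_neg_of_pos hlam)
    simpa using ((Real.tendsto_exp_atBot.comp this).const_mul K).mul_const ‖x 0‖
  refine squeeze_zero_norm' ?_ hexp
  filter_upwards [eventually_ge_atTop 0] with t ht using h x hx 0 t ht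

theorem tendsto_inner_clm_zero {p : ℝ → E →L[ℝ] E} {C : ℝ} (hp : ∀ t, ‖p t‖ ≤ C)
    {x y : ℝ → E} (hx : Tendsto x atTop (𝓝 0)) (hy : Tendsto y atTop (𝓝 0)) :
    Tendsto (fun t => ⟪y t, p t (x t)⟫) atTop (𝓝 0) := by
  have hlim : Tendsto (fun t => ‖y t‖ * (C * ‖x t‖)) atTop (𝓝 0) := by
    simpa using hy.norm.mul (hx.norm.const_mul C)
  refine squeeze_zero_norm (fun t => ?_) hlim
  refine (norm_inner_le_norm _ _).trans ?_
  gcongr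
  exact (p t).le_of_opNorm_le (hp t) _

variable [CompleteSpace E]

/-- Derivative of the bilinear form of a solution of the Lyapunov equation along trajectories. -/
theorem hasDerivAt_inner_lyapunov {a q p : ℝ → E →L[ℝ] E} {x y : ℝ → E} {t : ℝ}
    (hp : HasDerivAt p (-(adjoint (a t) * p t + p t * a t) + q t) t)
    (hx : HasDerivAt x (a t (x t)) t) (hy : HasDerivAt y (a t (y t)) t) :
    HasDerivAt (fun s => ⟪y s, p s (x s)⟫) ⟪y t, q t (x t)⟫ t := by
  convert! hy.inner ℝ (hp.clm_apply hx) using 1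
  simp only [add_apply, neg_apply, mul_apply_eq_comp, inner_add_right, inner_neg_right,
    adjoint_inner_right]
  ring

/-- The homogeneous Lyapunov operator `X ↦ -(a† X + X a)`. -/
noncomputable def lyapunovOp (a : E →L[ℝ] E) : (E →L[ℝ] E) →L[ℝ] (E →L[ℝ] E) :=
  -(ContinuousLinearMap.mul ℝ (E →L[ℝ] E) (adjoint a) +
    (ContinuousLinearMap.mul ℝ (E →L[ℝ] E)).flip a)

theorem lyapunovOp_apply (a X : E →L[ℝ] E) : lyapunovOp a X = -(adjoint a * X + X * a) := rfl

theorem continuous_lyapunovOp : Continuous (lyapunovOp (E := E)) := by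
  unfold lyapunovOp
  have : Continuous fun a : E →L[ℝ] E => adjoint a := LinearIsometryEquiv.continuous _
  fun_prop

variable {a q : ℝ → E →L[ℝ] E} {T : ℝ}

theorem IsExpStable.eq_zero_of_lyapunov (hs : IsExpStable a) (hT : 0 < T) (ha : Continuous a)
    (haper : Function.Periodic a T) {D : ℝ → E →L[ℝ] E}
    (hD : ∀ t, HasDerivAt D (lyapunovOp (a t) (D t)) t) (hDper : Function.Periodic D T) (t : ℝ) :
    D t = 0 := by
  obtain ⟨C, -, hC⟩ := exists_norm_le_of_periodic hT
    (continuous_iff_continuousAt.2 fun t => (hD t).continuousAt) hDper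
  ext u
  refine ext_inner_left ℝ fun v => ?_
  obtain ⟨x, rfl, hx⟩ := exists_hasDerivAt_linear hT ha haper t u
  obtain ⟨y, rfl, hy⟩ := exists_hasDerivAt_linear hT ha haper t v
  have hder : ∀ s, HasDerivAt (fun s => ⟪y s, D s (x s)⟫) 0 s := fun s => by
    simpa using hasDerivAt_inner_lyapunov (q := fun _ => 0) (by simpa [lyapunovOp_apply] using hD s) (hx s) (hy s)
  have hconst : ∀ s, ⟪y s, D s (x s)⟫ = ⟪y t, D t (x t)⟫ := fun s =>
    is_const_of_deriv_eq_zero (fun s => (hder s).differentiableAt) (fun s => (hder s).deriv) s t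
  have hlim := tendsto_inner_clm_zero hC (hs.tendsto_zero hx) (hs.tendsto_zero hy)
  simp only [hconst] at hlim
  simpa using tendsto_nhds_unique tendsto_const_nhds hlim

theorem IsExpStable.exists_periodic_lyapunov [FiniteDimensional ℝ E] (hs : IsExpStable a)
    (hT : 0 < T) (ha : Continuous a) (haper : Function.Periodic a T) (hq : Continuous q)
    (hqper : Function.Periodic q T) (hqsymm : ∀ t, adjoint (q t) = q t) :
    ∃ p : ℝ → E →L[ℝ] E, (∀ t, HasDerivAt p (lyapunovOp (a t) (p t) + -q t) t) ∧
      Function.Periodic p T ∧ ∀ t, adjoint (p t) = p t := by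
  obtain ⟨p, hp, hpper⟩ := exists_periodic_hasDerivAt_affine hT (continuous_lyapunovOp.comp ha)
    (fun t => by simp [haper t])
    (fun D hD hDper => hs.eq_zero_of_lyapunov hT ha haper hD hDper 0)
    (b := fun t => -q t) hq.neg (fun t => by simp [hqper t])
  refine ⟨p, hp, hpper, fun t => ?_⟩
  have hadj : ∀ t, HasDerivAt (fun t => adjoint (p t))
      (lyapunovOp (a t) (adjoint (p t)) + -q t) t := fun t => by
    have h := (adjoint (𝕜 := ℝ) (E := E)
      (F := E)).toContinuousLinearEquiv.hasFDerivAt.comp_hasDerivAt t (hp t)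
    convert! h using 1
    simp [lyapunovOp_apply, hqsymm, mul_def, adjoint_comp, add_comm]
  have h := hs.eq_zero_of_lyapunov hT ha haper (D := fun t => adjoint (p t) - p t)
    (fun t => by
      convert! (hadj t).sub (hp t) using 1
      rw [map_sub]
      abel) (fun t => by simp [hpper t]) t
  exact sub_eq_zero.1 h

theorem IsExpStable.exists_lower_bound (hs : IsExpStable a) (hT : 0 < T)
    (ha : Continuous a) (haper : Function.Periodic a T) {q₀ : ℝ} (hq₀ : 0 < q₀)
    (hq : ∀ t x, q₀ * ‖x‖ ^ 2 ≤ ⟪x, q t x⟫) {p : ℝ → E →L[ℝ] E}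
    (hp : ∀ t, HasDerivAt p (lyapunovOp (a t) (p t) + -q t) t) (hpper : Function.Periodic p T) :
    ∃ p₀ : ℝ, 0 < p₀ ∧ ∀ t x, p₀ * ‖x‖ ^ 2 ≤ ⟪x, p t x⟫ := by
  obtain ⟨M, hM0, hM⟩ := exists_norm_le_of_periodic hT ha haper
  obtain ⟨C, -, hC⟩ := exists_norm_le_of_periodic hT
    (continuous_iff_continuousAt.2 fun t => (hp t).continuousAt) hpper
  let c := q₀ / (2 * M + 1)
  have hc : 0 < c := by positivity
  have hcM : c * (2 * M + 1) = q₀ := div_mul_cancel₀ _ (by positivity)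
  refine ⟨c, hc, fun t u => ?_⟩
  obtain ⟨x, rfl, hx⟩ := exists_hasDerivAt_linear hT ha haper t u
  have hder : ∀ s, HasDerivAt (fun s => ⟪x s, p s (x s)⟫ - c * ⟪x s, x s⟫)
      (⟪x s, (-q s) (x s)⟫ - c * (⟪x s, a s (x s)⟫ + ⟪a s (x s), x s⟫)) s := fun s =>
    (hasDerivAt_inner_lyapunov (q := fun s => -q s) (hp s) (hx s) (hx s)).sub
      (((hx s).inner ℝ (hx s)).const_mul c)
  have hanti : Antitone fun s => ⟪x s, p s (x s)⟫ - c * ⟪x s, x s⟫ := by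
    refine antitone_of_hasDerivAt_nonpos hder fun s => ?_
    have h1 : |⟪x s, a s (x s)⟫| ≤ M * ‖x s‖ ^ 2 := by
      refine (abs_real_inner_le_norm _ _).trans ?_
      have := (a s).le_of_opNorm_le (hM s) (x s)
      nlinarith [norm_nonneg (x s)]
    have h2 := (abs_le.1 h1).1
    rw [real_inner_comm (x s) (a s (x s)), neg_apply, inner_neg_right]
    have h3 : q₀ * ‖x s‖ ^ 2 = 2 * (c * (M * ‖x s‖ ^ 2)) + c * ‖x s‖ ^ 2 := by
      rw [← hcM]
      ring
    have h4 : 0 ≤ c * ‖x s‖ ^ 2 := by positivity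
    change _ ≤ (0 : ℝ)
    linarith [hq s (x s), mul_le_mul_of_nonneg_left h2 hc.le]
  have hlim : Tendsto (fun s => ⟪x s, p s (x s)⟫ - c * ⟪x s, x s⟫) atTop (𝓝 0) := by
    have h0 := hs.tendsto_zero hx
    simpa using (tendsto_inner_clm_zero hC h0 h0).sub ((h0.inner h0).const_mul c)
  have := hanti.le_of_tendsto hlim t
  rw [← real_inner_self_eq_norm_sq]
  linarith

theorem isExpStable_of_lyapunov {q₀ p₀ p₁ : ℝ} (hq₀ : 0 < q₀) (hp₀ : 0 < p₀) (hp₁ : 0 < p₁)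
    (hq : ∀ t x, q₀ * ‖x‖ ^ 2 ≤ ⟪x, q t x⟫) {p : ℝ → E →L[ℝ] E}
    (hp : ∀ t, HasDerivAt p (lyapunovOp (a t) (p t) + -q t) t)
    (hlow : ∀ t x, p₀ * ‖x‖ ^ 2 ≤ ⟪x, p t x⟫) (hup : ∀ t x, ⟪x, p t x⟫ ≤ p₁ * ‖x‖ ^ 2) :
    IsExpStable a := by
  let μ := q₀ / p₁
  have hμ : μ * p₁ = q₀ := div_mul_cancel₀ _ hp₁.ne'
  have hμ0 : 0 < μ := by positivity
  refine ⟨Real.sqrt (p₁ / p₀), by positivity, μ / 2, by positivity, fun x hx s t hst => ?_⟩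
  have hder : ∀ s, HasDerivAt (fun s => Real.exp (μ * s) * ⟪x s, p s (x s)⟫)
      (Real.exp (μ * s) * (μ * 1) * ⟪x s, p s (x s)⟫ +
        Real.exp (μ * s) * ⟪x s, (-q s) (x s)⟫) s := fun s =>
    (((hasDerivAt_id s).const_mul μ).exp).mul
      (hasDerivAt_inner_lyapunov (q := fun s => -q s) (hp s) (hx s) (hx s))
  have hanti : Antitone fun s => Real.exp (μ * s) * ⟪x s, p s (x s)⟫ := by
    refine antitone_of_hasDerivAt_nonpos hder fun s => ?_
    rw [neg_apply, inner_neg_right, mul_assoc, ← mul_add]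
    refine mul_nonpos_of_nonneg_of_nonpos (Real.exp_pos _).le ?_
    have := mul_le_mul_of_nonneg_left (hup s (x s)) hμ0.le
    rw [← mul_assoc, hμ] at this
    linarith [hq s (x s)]
  have hV : ⟪x t, p t (x t)⟫ ≤ Real.exp (-μ * (t - s)) * ⟪x s, p s (x s)⟫ := by
    have h := hanti hst
    have he : Real.exp (-μ * (t - s)) = Real.exp (μ * s) / Real.exp (μ * t) := by
      rw [← Real.exp_sub]
      ring_nf
    rw [he, div_mul_eq_mul_div, le_div_iff₀ (Real.exp_pos _), mul_comm]
    exact h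
  refine abs_le_of_sq_le_sq' ?_ (by positivity) |>.2
  have he : Real.exp (-(μ / 2) * (t - s)) ^ 2 = Real.exp (-μ * (t - s)) := by
    rw [← Real.exp_nat_mul]
    push_cast
    ring_nf
  rw [mul_pow, mul_pow, Real.sq_sqrt (by positivity), he, div_mul_eq_mul_div, div_mul_eq_mul_div,
    le_div_iff₀ hp₀]
  have := mul_le_mul_of_nonneg_left (hup s (x s)) (Real.exp_pos (-μ * (t - s))).le
  linarith [hlow t (x t)]

end Lyapunov

section EuclideanMatrix

open Matrix ContinuousLinearMap

theorem mulVecE_eq_toEuclideanCLM {n : ℕ} (A : Matrix (Fin n) (Fin n) ℝ)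
    (v : EuclideanSpace ℝ (Fin n)) : mulVecE A v = toEuclideanCLM (𝕜 := ℝ) A v := rfl

theorem adjoint_toEuclideanCLM {n : ℕ} (A : Matrix (Fin n) (Fin n) ℝ) :
    adjoint (toEuclideanCLM (𝕜 := ℝ) A) = toEuclideanCLM (𝕜 := ℝ) A.transpose := by
  rw [← star_eq_adjoint, ← map_star, star_eq_conjTranspose, conjTranspose_eq_transpose_of_trivial]

theorem toEuclideanCLM_eq_sum {n : ℕ} (A : Matrix (Fin n) (Fin n) ℝ) :
    toEuclideanCLM (𝕜 := ℝ) A = ∑ i, ∑ j, A i j • toEuclideanCLM (𝕜 := ℝ) (single i j (1 : ℝ)) := by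
  conv_lhs => rw [matrix_eq_sum_single A]
  simp [← map_smul, map_sum, smul_single]

theorem continuous_toEuclideanCLM_comp {n : ℕ} {A : ℝ → Matrix (Fin n) (Fin n) ℝ}
    (hA : ∀ i j, Continuous fun t => A t i j) :
    Continuous fun t => toEuclideanCLM (𝕜 := ℝ) (A t) := by
  simp_rw [toEuclideanCLM_eq_sum (A _)]
  exact continuous_finsetSum _ fun i _ => continuous_finsetSum _ fun j _ =>
    (hA i j).smul continuous_const

theorem hasDerivAt_toEuclideanCLM_comp {n : ℕ} {P : ℝ → Matrix (Fin n) (Fin n) ℝ}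
    {P' : Matrix (Fin n) (Fin n) ℝ} {t : ℝ}
    (hP : ∀ i j, HasDerivAt (fun u => P u i j) (P' i j) t) :
    HasDerivAt (fun u => toEuclideanCLM (𝕜 := ℝ) (P u)) (toEuclideanCLM (𝕜 := ℝ) P') t := by
  simp_rw [toEuclideanCLM_eq_sum (P _), toEuclideanCLM_eq_sum P']
  exact HasDerivAt.fun_sum fun i _ => HasDerivAt.fun_sum fun j _ =>
    (hP i j).smul_const (toEuclideanCLM (𝕜 := ℝ) (single i j (1 : ℝ)))

/-- The `(i, j)` entry of the matrix of an operator, as a continuous linear functional. -/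
noncomputable def entryCLM {n : ℕ} (i j : Fin n) :
    (EuclideanSpace ℝ (Fin n) →L[ℝ] EuclideanSpace ℝ (Fin n)) →L[ℝ] ℝ :=
  LinearMap.toContinuousLinearMap
    (entryLinearMap ℝ ℝ i j ∘ₗ
      ((toEuclideanCLM (𝕜 := ℝ) (n := Fin n)).symm.toAlgEquiv.toLinearEquiv.toLinearMap))

theorem entryCLM_apply {n : ℕ} (i j : Fin n)
    (X : EuclideanSpace ℝ (Fin n) →L[ℝ] EuclideanSpace ℝ (Fin n)) :
    entryCLM i j X = (toEuclideanCLM (𝕜 := ℝ)).symm X i j := rfl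

/-- The Lyapunov matrix equation in terms of the associated operators. -/
theorem lyapunov_matrix_iff {n : ℕ} (A Q P P' : Matrix (Fin n) (Fin n) ℝ) :
    P' + A.transpose * P + P * A + Q = 0 ↔
      toEuclideanCLM (𝕜 := ℝ) P' = lyapunovOp (toEuclideanCLM (𝕜 := ℝ) A)
        (toEuclideanCLM (𝕜 := ℝ) P) + -toEuclideanCLM (𝕜 := ℝ) Q := by
  rw [lyapunovOp_apply, adjoint_toEuclideanCLM, ← map_mul, ← map_mul, ← map_add, ← map_neg,
    ← map_neg, ← map_add, (EquivLike.injective (toEuclideanCLM (𝕜 := ℝ) (n := Fin n))).eq_iff,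
    ← sub_eq_zero (a := P')]
  constructor <;> intro h <;> rw [← h] <;> abel

end EuclideanMatrix

/-- The equivalence 2 ↔ 3 of Theorem 3 of the paper: a `T`-periodic linear system
`ẋ = A(t)x` is exponentially stable if and only if, for the given continuous,
`T`-periodic, symmetric, uniformly positive definite `Q`, the periodic Lyapunov
differential equation `Ṗ + AᵀP + PA + Q = 0` admits a continuously differentiable,
`T`-periodic, symmetric, uniformly positive definite and bounded solution `P`. -/
theorem periodic_lyapunov_equation_iff_exponential_stability
    (n : ℕ) (hn : 1 ≤ n) (T : ℝ) (hT : 0 < T)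
    (A Q : ℝ → Matrix (Fin n) (Fin n) ℝ)
    (hAc : ∀ i j, Continuous fun t => A t i j)
    (hAper : ∀ t, A (t + T) = A t)
    (hQc : ∀ i j, Continuous fun t => Q t i j)
    (hQper : ∀ t, Q (t + T) = Q t)
    (hQsymm : ∀ t, (Q t).transpose = Q t)
    (q₀ : ℝ) (hq₀ : 0 < q₀)
    (hQpos : ∀ t, ∀ x : EuclideanSpace ℝ (Fin n),
      q₀ * ‖x‖ ^ 2 ≤ ⟪x, mulVecE (Q t) x⟫) :
    (∃ K > (0 : ℝ), ∃ lam > (0 : ℝ), ∀ x : ℝ → EuclideanSpace ℝ (Fin n),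
        (∀ t, HasDerivAt x (mulVecE (A t) (x t)) t) →
        ∀ s t : ℝ, s ≤ t → ‖x t‖ ≤ K * Real.exp (-lam * (t - s)) * ‖x s‖)
      ↔
    (∃ P P' : ℝ → Matrix (Fin n) (Fin n) ℝ,
        (∀ t i j, HasDerivAt (fun u => P u i j) (P' t i j) t) ∧
        (∀ i j, Continuous fun t => P' t i j) ∧
        (∀ t, P (t + T) = P t) ∧
        (∀ t, (P t).transpose = P t) ∧
        (∃ p₀ p₁ : ℝ, 0 < p₀ ∧ p₀ ≤ p₁ ∧
          ∀ t, ∀ x : EuclideanSpace ℝ (Fin n),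
            p₀ * ‖x‖ ^ 2 ≤ ⟪x, mulVecE (P t) x⟫ ∧
            ⟪x, mulVecE (P t) x⟫ ≤ p₁ * ‖x‖ ^ 2) ∧
        (∀ t, P' t + (A t).transpose * P t + P t * A t + Q t = 0)) := by
  let Φ := Matrix.toEuclideanCLM (𝕜 := ℝ) (n := Fin n)
  have hac := continuous_toEuclideanCLM_comp hAc
  have haper : Function.Periodic (fun t => Φ (A t)) T := fun t => congrArg Φ (hAper t)
  constructor
  · intro hs
    have hs : IsExpStable fun t => Φ (A t) := hs
    obtain ⟨p, hp, hpper, hpsymm⟩ := hs.exists_periodic_lyapunov hT hac haper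
      (continuous_toEuclideanCLM_comp hQc) (fun t => congrArg Φ (hQper t))
      (fun t => by rw [adjoint_toEuclideanCLM, hQsymm])
    obtain ⟨p₀, hp₀, hlow⟩ := hs.exists_lower_bound hT hac haper hq₀ hQpos hp hpper
    have hpc : Continuous p := continuous_iff_continuousAt.2 fun t => (hp t).continuousAt
    obtain ⟨C, -, hC⟩ := exists_norm_le_of_periodic hT hpc hpper
    let dp := fun t => lyapunovOp (Φ (A t)) (p t) + -Φ (Q t)
    have hdpc : Continuous dp :=
      ((continuous_lyapunovOp.comp hac).clm_apply hpc).add (continuous_toEuclideanCLM_comp hQc).neg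
    refine ⟨fun t => Φ.symm (p t), fun t => Φ.symm (dp t),
      fun t i j => (entryCLM i j).hasFDerivAt.comp_hasDerivAt t (hp t),
      fun i j => (entryCLM i j).continuous.comp hdpc,
      fun t => congrArg Φ.symm (hpper t), fun t => EquivLike.injective Φ ?_,
      ⟨p₀, max p₀ C, hp₀, le_max_left _ _, fun t x => ?_⟩, fun t => ?_⟩
    · refine (adjoint_toEuclideanCLM _).symm.trans ?_
      simpa [Φ] using hpsymm t
    · have hval : mulVecE (Φ.symm (p t)) x = p t x := by
        rw [mulVecE_eq_toEuclideanCLM]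
        exact congrArg (fun X => X x) (Φ.apply_symm_apply (p t))
      rw [hval]
      refine ⟨hlow t x, (real_inner_le_norm _ _).trans ?_⟩
      have h1 := (p t).le_of_opNorm_le ((hC t).trans (le_max_right p₀ C)) x
      nlinarith [norm_nonneg x]
    · rw [lyapunov_matrix_iff]
      simp [Φ, dp]
  · rintro ⟨P, P', hP, -, -, -, ⟨p₀, p₁, hp₀, hp₁, hb⟩, hL⟩
    refine isExpStable_of_lyapunov (a := fun t => Φ (A t)) (q := fun t => Φ (Q t))
      (p := fun t => Φ (P t)) hq₀ hp₀ (hp₀.trans_le hp₁) hQpos (fun t => ?_)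
      (fun t x => (hb t x).1) (fun t x => (hb t x).2)
    rw [← (lyapunov_matrix_iff _ _ _ _).1 (hL t)]
    exact hasDerivAt_toEuclideanCLM_comp (hP t)
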